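/- Let α > 0, M > 0, and let f = (f_1, …, f_n) : B^n → C^n be continuously differentiable with all partial derivatives ∂f_j/∂z_k and ∂f_j/∂z̄_k (1 ≤ j, k ≤ n) hyperbolic-harmonic on B^n. Suppose f(0) = 0, det J_f(0) = 1 and ‖f‖_{HB_n(α)} = sup_{z∈B^n} (1−|z|²)^α ( |f_z(z)| + |f_{z̄}(z)| ) ≤ M. Then f is injective (univalent) on the ball B^n(ρ/2), where ρ = 3^α / ( (2M)^{2n} (3^α + 4^α) ). -/

import Mathlib

open MeasureTheory Metric Complex

noncomputable section

/-- `ℂⁿ` with the Euclidean norm. -/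
abbrev Cn (n : ℕ) := EuclideanSpace ℂ (Fin n)

/-- The Wirtinger derivative `∂f/∂z_k = (∂f/∂x_k - i ∂f/∂y_k)/2`. -/
noncomputable def wdz (n : ℕ) (f : Cn n → ℂ) (z : Cn n) (k : Fin n) : ℂ :=
  (1 / 2 : ℂ) *
    (fderiv ℝ f z (EuclideanSpace.single k 1) -
      Complex.I * fderiv ℝ f z (EuclideanSpace.single k Complex.I))

/-- The Wirtinger derivative `∂f/∂z̄_k = (∂f/∂x_k + i ∂f/∂y_k)/2`. -/
noncomputable def wdzbar (n : ℕ) (f : Cn n → ℂ) (z : Cn n) (k : Fin n) : ℂ :=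
  (1 / 2 : ℂ) *
    (fderiv ℝ f z (EuclideanSpace.single k 1) +
      Complex.I * fderiv ℝ f z (EuclideanSpace.single k Complex.I))

/-- Euclidean norm of a vector of complex numbers. -/
noncomputable def euclNorm (n : ℕ) (v : Fin n → ℂ) : ℝ :=
  Real.sqrt (∑ k, Complex.normSq (v k))

/-- The Laplace–Beltrami operator
`Δ_h u = (1-|z|²)² Σ_k (u_{x_k x_k} + u_{y_k y_k})
  + 4(n-1)(1-|z|²) Σ_k (x_k u_{x_k} + y_k u_{y_k})`. -/
noncomputable def laplaceH (n : ℕ) (u : Cn n → ℝ) (z : Cn n) : ℝ :=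
  (1 - ‖z‖ ^ 2) ^ 2 *
      ∑ k, (fderiv ℝ (fun w => fderiv ℝ u w (EuclideanSpace.single k 1)) z
              (EuclideanSpace.single k 1) +
            fderiv ℝ (fun w => fderiv ℝ u w (EuclideanSpace.single k Complex.I)) z
              (EuclideanSpace.single k Complex.I)) +
    4 * ((n : ℝ) - 1) * (1 - ‖z‖ ^ 2) *
      ∑ k, ((z k).re * fderiv ℝ u z (EuclideanSpace.single k 1) +
            (z k).im * fderiv ℝ u z (EuclideanSpace.single k Complex.I))

/-- A complex-valued function on the unit ball of `ℂⁿ` is hyperbolic-harmonic if it is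
twice continuously differentiable there and its real and imaginary parts are annihilated
by the Laplace–Beltrami operator. -/
def IsHHarmonic (n : ℕ) (f : Cn n → ℂ) : Prop :=
  ContDiffOn ℝ 2 f (ball 0 1) ∧
    ∀ z ∈ ball (0 : Cn n) 1,
      laplaceH n (fun w => (f w).re) z = 0 ∧ laplaceH n (fun w => (f w).im) z = 0
/-- The operator norm `|A| = max{|Aθ| : θ ∈ ∂Bⁿ}` of an `n×n` complex matrix, with respect to
the Euclidean norm. -/
noncomputable def matOpNorm (n : ℕ) (A : Matrix (Fin n) (Fin n) ℂ) : ℝ :=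
  sSup ((fun θ : Cn n => euclNorm n (A.mulVec fun k => θ k)) '' sphere (0 : Cn n) 1)
/-- The matrix `f_z = (∂f_j/∂z_k)` of Wirtinger derivatives of the components of `f`. -/
noncomputable def fzMat (n : ℕ) (f : Cn n → Cn n) (z : Cn n) : Matrix (Fin n) (Fin n) ℂ :=
  fun j k => wdz n (fun w => f w j) z k

/-- The matrix `f_{z̄} = (∂f_j/∂z̄_k)` of Wirtinger derivatives of the components of `f`. -/
noncomputable def fzbarMat (n : ℕ) (f : Cn n → Cn n) (z : Cn n) : Matrix (Fin n) (Fin n) ℂ :=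
  fun j k => wdzbar n (fun w => f w j) z k

/-- The real `2n×2n` Jacobian matrix of `f : ℂⁿ → ℂⁿ` viewed as a map of the `2n` real
variables `x_1, y_1, …, x_n, y_n`, with rows indexed by `(Re f_j, Im f_j)`. Index `(j, 0)`
stands for `Re f_j` (resp. direction `x_j`) and `(j, 1)` for `Im f_j` (resp. `y_j`). -/
noncomputable def realJac (n : ℕ) (f : Cn n → Cn n) (z : Cn n) :
    Matrix (Fin n × Fin 2) (Fin n × Fin 2) ℝ :=
  fun p q =>
    if p.2 = 0 then
      fderiv ℝ (fun w => (f w p.1).re) z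
        (EuclideanSpace.single q.1 (if q.2 = 0 then 1 else Complex.I))
    else
      fderiv ℝ (fun w => (f w p.1).im) z
        (EuclideanSpace.single q.1 (if q.2 = 0 then 1 else Complex.I))

/-- `f` belongs to `𝒫ℋ(Bⁿ, ℂⁿ)` with all Wirtinger partial derivatives `h`-harmonic:
`f` is continuously differentiable on `Bⁿ` and each `∂f_j/∂z_k`, `∂f_j/∂z̄_k` is
hyperbolic-harmonic. -/
def IsPHH (n : ℕ) (f : Cn n → Cn n) : Prop :=
  ContDiffOn ℝ 1 f (ball 0 1) ∧
    ∀ j k : Fin n, IsHHarmonic n (fun w => fzMat n f w j k) ∧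
      IsHHarmonic n (fun w => fzbarMat n f w j k)

section Helpers
open Filter Topology


lemma second_test (g g' : ℝ → ℝ) (c : ℝ) (h1 : ∀ᶠ t in 𝓝 (0:ℝ), HasDerivAt g (g' t) t)
    (h2 : HasDerivAt g' c 0) (hm : IsLocalMax g 0) : c ≤ 0 := by
  by_contra hc
  push Not at hc
  have e1 : deriv g =ᶠ[𝓝 0] g' := h1.mono fun t ht => ht.deriv
  have e2 : deriv (deriv g) 0 = c := by rw [e1.deriv_eq]; exact h2.deriv
  have hmin : IsLocalMin g 0 := isLocalMin_of_deriv_deriv_pos (by rw [e2]; exact hc)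
    hm.deriv_eq_zero h1.self_of_nhds.continuousAt
  have e3 : g =ᶠ[𝓝 0] fun _ => g 0 := by
    filter_upwards [hm, hmin] with t a b
    exact le_antisymm a b
  have e4 : deriv g =ᶠ[𝓝 0] fun _ => 0 := by
    have := e3.deriv
    simpa using this
  have e5 : deriv (deriv g) 0 = 0 := by rw [e4.deriv_eq]; simp
  linarith

lemma line_test {E : Type*} [NormedAddCommGroup E] [NormedSpace ℝ E] (u : E → ℝ) (x y v v' : E)
    (hx : ContDiffAt ℝ 2 u x) (hy : ContDiffAt ℝ 2 u y) (p1 p2 : ℝ)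
    (hm : IsLocalMax (fun t : ℝ => u (x + t • v) - u (y + t • v') - (p1 * t + p2 * t^2)) 0) :
    fderiv ℝ u x v - fderiv ℝ u y v' = p1 ∧
    fderiv ℝ (fderiv ℝ u) x v v - fderiv ℝ (fderiv ℝ u) y v' v' ≤ 2 * p2 := by
  have key : ∀ (x v : E), ContDiffAt ℝ 2 u x →
      (∀ᶠ t in 𝓝 (0:ℝ), HasDerivAt (fun t : ℝ => u (x + t • v)) (fderiv ℝ u (x + t • v) v) t) ∧
      HasDerivAt (fun t : ℝ => fderiv ℝ u (x + t • v) v) (fderiv ℝ (fderiv ℝ u) x v v) 0 := by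
    intro x v hx
    have hl : ∀ t : ℝ, HasDerivAt (fun t : ℝ => x + t • v) v t := fun t => by
      simpa using ((hasDerivAt_id t).smul_const v).const_add x
    constructor
    · have e : ∀ᶠ z in 𝓝 x, DifferentiableAt ℝ u z := by
        have := hx.eventually (by simp)
        exact this.mono fun z hz => hz.differentiableAt (by norm_num)
      have ht : Tendsto (fun t : ℝ => x + t • v) (𝓝 0) (𝓝 x) := by
        have := (hl 0).continuousAt.tendsto
        simpa using this
      filter_upwards [ht.eventually e] with t ht
      exact ht.hasFDerivAt.comp_hasDerivAt t (hl t)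
    · have hd : DifferentiableAt ℝ (fderiv ℝ u) x :=
        (hx.fderiv_right (m := 1) (by norm_num)).differentiableAt (by norm_num)
      have h0 : HasFDerivAt (fderiv ℝ u) (fderiv ℝ (fderiv ℝ u) x) (x + (0:ℝ) • v) := by
        simpa using hd.hasFDerivAt
      have := (h0.comp_hasDerivAt (0:ℝ) (hl 0))
      exact this.clm_apply (hasDerivAt_const (0:ℝ) v) |>.congr_deriv (by simp)
  obtain ⟨a1, a2⟩ := key x v hx
  obtain ⟨b1, b2⟩ := key y v' hy
  have q1 : ∀ t : ℝ, HasDerivAt (fun t : ℝ => p1 * t + p2 * t^2) (p1 + 2 * p2 * t) t := fun t => by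
    have := ((hasDerivAt_id t).const_mul p1).add (((hasDerivAt_id t).pow 2).const_mul p2)
    refine this.congr_deriv ?_
    simp; ring
  have q2 : HasDerivAt (fun t : ℝ => p1 + 2 * p2 * t) (2 * p2) 0 := by
    have := ((hasDerivAt_id (0:ℝ)).const_mul (2 * p2)).const_add p1
    simpa using this
  have g1 : ∀ᶠ t in 𝓝 (0:ℝ), HasDerivAt
      (fun t : ℝ => u (x + t • v) - u (y + t • v') - (p1 * t + p2 * t^2))
      (fderiv ℝ u (x + t • v) v - fderiv ℝ u (y + t • v') v' - (p1 + 2 * p2 * t)) t := by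
    filter_upwards [a1, b1] with t h h'
    exact (h.sub h').sub (q1 t)
  constructor
  · have := hm.hasDerivAt_eq_zero g1.self_of_nhds
    simp at this
    linarith
  · have := second_test _ _ _ g1 ((a2.sub b2).sub q2) hm
    linarith

lemma final_arith (n : ℕ) (hn : 1 ≤ n) (A P a b s p X Y Q : ℝ) (hA : 0 < A) (hspos : 0 < s)
    (hPP : (4:ℝ)^n = P^2) (hP2 : 2 ≤ P) (ha : a = 4 * P * A) (hbdef : b = 2 * P^2 * A)
    (hsP' : s * P < 1) (hp : p = a / s - 2 * b)
    (i3 : s^2 = X - 2 * Q + Y) (hX4 : X ≤ 1/4) (hY4 : Y ≤ 1/4) (hX0 : 0 ≤ X) (hY0 : 0 ≤ Y)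
    (hXY : (X - Y)^2 ≤ s^2)
    (hsum : -(4 * ((n:ℝ) - 1) / (1 - X)) * (p * (X - Q) + 8 * A * X) -
      -(4 * ((n:ℝ) - 1) / (1 - Y)) * (p * (Q - Y) - 8 * A * Y) ≤ 32 * n * A - 8 * b) : False := by
  have hps : p * s = a - 2 * b * s := by rw [hp]; field_simp
  have hp0 : 0 ≤ p := by
    have : 0 ≤ p * s := by
      rw [hps, ha, hbdef]
      have : 4 * P * A - 2 * (2 * P^2 * A) * s = 4 * P * A * (1 - s * P) := by ring
      rw [this]
      exact mul_nonneg (by positivity) (by linarith)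
    exact nonneg_of_mul_nonneg_left this hspos
  have hps2 : p * s^2 ≤ A := by
    have : p * s^2 = 4 * A * (s * P) * (1 - s * P) := by
      rw [pow_two, ← mul_assoc, hps, ha, hbdef]; ring
    rw [this]
    nlinarith [mul_nonneg hA.le (sq_nonneg (s * P - 1/2))]
  set N : ℝ := 4 * ((n:ℝ) - 1) with hN
  have hn1 : (1:ℝ) ≤ n := by exact_mod_cast hn
  have hN0 : 0 ≤ N := by rw [hN]; linarith
  set cX := 1 / (1 - X) with hcX
  set cY := 1 / (1 - Y) with hcY
  have cX1 : cX ≤ 4/3 := by rw [hcX, div_le_iff₀ (by linarith)]; linarith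
  have cY1 : cY ≤ 4/3 := by rw [hcY, div_le_iff₀ (by linarith)]; linarith
  have cX0 : 0 < cX := by rw [hcX]; apply div_pos <;> linarith
  have cY0 : 0 < cY := by rw [hcY]; apply div_pos <;> linarith
  have hcd : cX - cY = (X - Y) * (cX * cY) := by
    have : 1 - X ≠ 0 := by linarith
    have : 1 - Y ≠ 0 := by linarith
    rw [hcX, hcY]; field_simp; ring
  have d1 : N / (1 - X) = N * cX := by rw [hcX]; ring
  have d2 : N / (1 - Y) = N * cY := by rw [hcY]; ring
  rw [d1, d2] at hsum
  have drift : cX * (X - Q) - cY * (Q - Y) ≤ 20 / 9 * s^2 := by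
    have h1 : cX * (X - Q) - cY * (Q - Y) = (cX + cY) / 2 * s^2 + (X - Y)^2 * (cX * cY) / 2 := by
      rw [i3]
      linear_combination (X - Y) / 2 * hcd
    have h2 : cX * cY ≤ 16/9 := (mul_le_mul cX1 cY1 cY0.le (by norm_num)).trans (by norm_num)
    have h3 : (X - Y)^2 * (cX * cY) ≤ s^2 * (16/9) :=
      mul_le_mul hXY h2 (by positivity) (by positivity)
    have h4 : (cX + cY) / 2 * s^2 ≤ 4/3 * s^2 :=
      mul_le_mul_of_nonneg_right (by linarith) (by positivity)
    rw [h1]; linarith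
  have pd : p * (cX * (X - Q) - cY * (Q - Y)) ≤ 20/9 * A := by
    calc _ ≤ p * (20/9 * s^2) := mul_le_mul_of_nonneg_left drift hp0
      _ = 20/9 * (p * s^2) := by ring
      _ ≤ _ := by linarith
  have e1 : cX * X ≤ 1/3 := (mul_le_mul cX1 hX4 hX0 (by norm_num)).trans (by norm_num)
  have e2 : cY * Y ≤ 1/3 := (mul_le_mul cY1 hY4 hY0 (by norm_num)).trans (by norm_num)
  have tot : p * (cX * (X - Q) - cY * (Q - Y)) + 8 * A * (cX * X + cY * Y) ≤ (20/9 + 16/3) * A := by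
    have : 8 * A * (cX * X + cY * Y) ≤ 8 * A * (2/3) :=
      mul_le_mul_of_nonneg_left (by linarith) (by positivity)
    linarith
  have tot2 := mul_le_mul_of_nonneg_left tot hN0
  have hPn : 4 * (n:ℝ) ≤ P^2 := by
    rw [← hPP]
    have := one_add_mul_le_pow (a := (3:ℝ)) (by norm_num) n
    have h4 : (4:ℝ)^n = 4 * 4^(n-1) := by rw [← pow_succ']; congr 1; omega
    have h5 := one_add_mul_le_pow (a := (3:ℝ)) (by norm_num) (n-1)
    have h6 : ((n-1 : ℕ):ℝ) = n - 1 := by rw [Nat.cast_sub hn]; simp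
    rw [h6] at h5
    norm_num at h5
    rw [h4]; linarith
  have hbn : 8 * n * A ≤ b := by
    rw [hbdef]
    have := mul_le_mul_of_nonneg_right hPn hA.le
    linarith
  have fin : 8 * b ≤ 32 * n * A + N * ((20/9 + 16/3) * A) := by linarith
  rw [hN] at fin
  have hnA := mul_pos (by linarith : (0:ℝ) < n) hA
  linarith

set_option maxHeartbeats 1000000 in
lemma max_principle {E : Type*} [NormedAddCommGroup E] [InnerProductSpace ℝ E]
    [FiniteDimensional ℝ E] (n : ℕ) (hn : 1 ≤ n) (hd : Module.finrank ℝ E = 2 * n)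
    (u : E → ℝ) (hu : ContDiffOn ℝ 2 u (ball 0 1))
    (hL : ∀ x ∈ ball (0 : E) 1,
      Laplacian.laplacian u x = - (4 * ((n:ℝ) - 1) / (1 - ‖x‖^2)) * fderiv ℝ u x x)
    (A : ℝ) (hA : 0 < A) (hb : ∀ x, ‖x‖ ≤ 1/2 → |u x| ≤ A)
    (x y : E) (hx : ‖x‖ ≤ 1/2) (hy : ‖y‖ ≤ 1/2) (hxy : ‖x - y‖ ≤ 1 / 2^n) :
    u x - u y ≤ 4 * 2^n * A * ‖x - y‖ - 2 * 4^n * A * ‖x - y‖^2 + 4 * A * (‖x‖^2 + ‖y‖^2) := by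
  set a : ℝ := 4 * 2^n * A with ha
  set b : ℝ := 2 * 4^n * A with hbdef
  set K : Set (E × E) := {p | ‖p.1‖ ≤ 1/2 ∧ ‖p.2‖ ≤ 1/2 ∧ ‖p.1 - p.2‖ ≤ 1 / 2^n} with hK
  set Φ : E × E → ℝ := fun p => u p.1 - u p.2 - a * ‖p.1 - p.2‖ + b * ‖p.1 - p.2‖^2
    - 4 * A * (‖p.1‖^2 + ‖p.2‖^2) with hΦ
  have hKc : IsCompact K := by
    have h1 : IsCompact (closedBall (0:E) (1/2) ×ˢ closedBall (0:E) (1/2)) :=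
      (isCompact_closedBall _ _).prod (isCompact_closedBall _ _)
    refine h1.of_isClosed_subset ?_ ?_
    · have c1 : IsClosed {p : E × E | ‖p.1‖ ≤ 1/2} := isClosed_le (by fun_prop) (by fun_prop)
      have c2 : IsClosed {p : E × E | ‖p.2‖ ≤ 1/2} := isClosed_le (by fun_prop) (by fun_prop)
      have c3 : IsClosed {p : E × E | ‖p.1 - p.2‖ ≤ 1 / 2^n} :=
        isClosed_le (by fun_prop) (by fun_prop)
      exact c1.inter (c2.inter c3)
    · rintro ⟨p, q⟩ ⟨h1, h2, -⟩
      exact ⟨mem_closedBall_zero_iff.2 h1, mem_closedBall_zero_iff.2 h2⟩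
  have huc : ContinuousOn u (ball 0 1) := hu.continuousOn
  have hin : ∀ z : E, ‖z‖ ≤ 1/2 → z ∈ ball (0:E) 1 := fun z hz => by
    simp; linarith
  have hΦc : ContinuousOn Φ K := by
    have c1 : ContinuousOn (fun p : E × E => u p.1) K :=
      huc.comp continuous_fst.continuousOn (fun p hp => hin _ hp.1)
    have c2 : ContinuousOn (fun p : E × E => u p.2) K :=
      huc.comp continuous_snd.continuousOn (fun p hp => hin _ hp.2.1)
    have c3 : Continuous (fun p : E × E => a * ‖p.1 - p.2‖) := by fun_prop
    have c4 : Continuous (fun p : E × E => b * ‖p.1 - p.2‖^2) := by fun_prop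
    have c5 : Continuous (fun p : E × E => 4 * A * (‖p.1‖^2 + ‖p.2‖^2)) := by fun_prop
    exact (((c1.sub c2).sub c3.continuousOn).add c4.continuousOn).sub c5.continuousOn
  have hxyK : (x, y) ∈ K := ⟨hx, hy, hxy⟩
  obtain ⟨⟨x0, y0⟩, hm0, hmax⟩ := hKc.exists_isMaxOn ⟨_, hxyK⟩ hΦc
  suffices h : Φ (x0, y0) ≤ 0 by
    have h1 : Φ (x, y) ≤ Φ (x0, y0) := hmax hxyK
    simp only [hΦ] at h1 h
    linarith
  by_contra hpos
  push Not at hpos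
  clear x y hx hy hxy hxyK
  rename' x0 => x, y0 => y
  obtain ⟨hx, hy, hxy⟩ := hm0
  simp only at hx hy hxy
  have hpos' : 0 < u x - u y - a * ‖x - y‖ + b * ‖x - y‖^2 - 4 * A * (‖x‖^2 + ‖y‖^2) := hpos
  set s := ‖x - y‖ with hs
  have hs0 : 0 ≤ s := norm_nonneg _
  set P : ℝ := 2^n with hP
  have hP2 : (2:ℝ) ≤ P := by
    calc (2:ℝ) = 2^1 := by norm_num
      _ ≤ 2^n := pow_le_pow_right₀ (by norm_num) hn
  have hPP : (4:ℝ)^n = P^2 := by rw [hP, ← pow_mul, mul_comm, pow_mul]; norm_num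
  rw [hPP] at hbdef
  have hsP : s * P ≤ 1 := by rwa [le_div_iff₀ (by positivity)] at hxy
  have hux := abs_le.1 (hb x hx)
  have huy := abs_le.1 (hb y hy)
  -- boundary exclusions
  have hsne : s ≠ 0 := by
    intro h
    have : x = y := by rw [← sub_eq_zero, ← norm_eq_zero]; exact h
    subst this
    rw [h] at hpos'
    nlinarith [sq_nonneg ‖x‖]
  have hspos : 0 < s := lt_of_le_of_ne hs0 (Ne.symm hsne)
  have hsP' : s * P < 1 := by
    refine lt_of_le_of_ne hsP fun h => ?_
    have e1 : a * s = 4 * A := by rw [ha]; linear_combination 4 * A * h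
    have e2 : b * s^2 = 2 * A := by rw [hbdef]; linear_combination 2 * A * (s * P + 1) * h
    linarith [mul_nonneg hA.le (sq_nonneg ‖x‖), mul_nonneg hA.le (sq_nonneg ‖y‖)]
  have habs : |‖x‖ - ‖y‖| ≤ s := abs_norm_sub_norm_le x y
  have hbdy : a * s - b * s^2 ≥ 4 * A * s := by
    have e : a * s - b * s^2 = 2 * A * (P * s) * (2 - s * P) := by rw [ha, hbdef]; ring
    rw [e]
    have : 2 * A * (P * s) * (2 - s * P) ≥ 2 * A * (P * s) * 1 :=
      mul_le_mul_of_nonneg_left (by linarith) (by positivity)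
    nlinarith [mul_pos hA hspos]
  have hs12 : s ≤ 1/2 := by nlinarith
  have hx' : ‖x‖ < 1/2 := by
    refine lt_of_le_of_ne hx fun h => ?_
    have h2 : 1/2 - s ≤ ‖y‖ := by have := (abs_le.1 habs).2; linarith
    have h3 : (1/2 - s)^2 ≤ ‖y‖^2 := pow_le_pow_left₀ (by linarith) h2 2
    rw [h] at hpos'
    linarith [mul_nonneg hA.le (sq_nonneg s), mul_le_mul_of_nonneg_left h3 hA.le]
  have hy' : ‖y‖ < 1/2 := by
    refine lt_of_le_of_ne hy fun h => ?_
    have h2 : 1/2 - s ≤ ‖x‖ := by have := (abs_le.1 habs).1; linarith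
    have h3 : (1/2 - s)^2 ≤ ‖x‖^2 := pow_le_pow_left₀ (by linarith) h2 2
    rw [h] at hpos'
    linarith [mul_nonneg hA.le (sq_nonneg s), mul_le_mul_of_nonneg_left h3 hA.le]
  have hxyP : s < 1 / P := by rw [lt_div_iff₀ (by positivity)]; exact hsP'
  -- local maximality along lines
  have hloc : ∀ v w : E, ∀ᶠ t in 𝓝 (0:ℝ), Φ (x + t • v, y + t • w) ≤ Φ (x, y) := by
    intro v w
    have k1 : ∀ᶠ t in 𝓝 (0:ℝ), ‖x + t • v‖ < 1/2 :=
      (Continuous.tendsto' (by fun_prop) 0 ‖x‖ (by simp) :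
        Tendsto (fun t : ℝ => ‖x + t • v‖) (𝓝 0) (𝓝 ‖x‖)).eventually_lt_const hx'
    have k2 : ∀ᶠ t in 𝓝 (0:ℝ), ‖y + t • w‖ < 1/2 :=
      (Continuous.tendsto' (by fun_prop) 0 ‖y‖ (by simp) :
        Tendsto (fun t : ℝ => ‖y + t • w‖) (𝓝 0) (𝓝 ‖y‖)).eventually_lt_const hy'
    have k3 : ∀ᶠ t in 𝓝 (0:ℝ), ‖(x + t • v) - (y + t • w)‖ < 1/P :=
      (Continuous.tendsto' (by fun_prop) 0 ‖x - y‖ (by simp) :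
        Tendsto (fun t : ℝ => ‖(x + t • v) - (y + t • w)‖) (𝓝 0) (𝓝 ‖x - y‖)).eventually_lt_const
          hxyP
    filter_upwards [k1, k2, k3] with t h1 h2 h3
    exact hmax (show (x + t • v, y + t • w) ∈ K from ⟨h1.le, h2.le, h3.le⟩)
  have hcx : ContDiffAt ℝ 2 u x := hu.contDiffAt (isOpen_ball.mem_nhds (hin x hx))
  have hcy : ContDiffAt ℝ 2 u y := hu.contDiffAt (isOpen_ball.mem_nhds (hin y hy))
  have nsq : ∀ (z v : E) (t : ℝ), ‖z + t • v‖^2 = ‖z‖^2 + 2 * t * inner ℝ z v + t^2 * ‖v‖^2 := by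
    intro z v t
    rw [norm_add_sq_real, inner_smul_right, norm_smul, mul_pow, Real.norm_eq_abs, sq_abs]; ring
  have hPpos : 0 < P := by linarith
  have hapos : 0 < a := by rw [ha]; positivity
  have hbpos : 0 < b := by rw [hbdef]; positivity
  set ξ := x - y with hξ
  -- first order
  have first : ∀ v w : E, fderiv ℝ u x v - fderiv ℝ u y w =
      (a / s - 2 * b) * inner ℝ ξ (v - w) + 8 * A * (inner ℝ x v + inner ℝ y w) := by
    intro v w
    refine (line_test u x y v w hcx hcy _
      ((a / (2 * s) - b) * ‖v - w‖^2 + 4 * A * (‖v‖^2 + ‖w‖^2)) ?_).1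
    filter_upwards [hloc v w] with t ht
    simp only [hΦ] at ht
    have e : (x + t • v) - (y + t • w) = ξ + t • (v - w) := by rw [hξ, smul_sub]; abel
    rw [e] at ht
    have hq : ‖ξ + t • (v - w)‖ ≤ (‖ξ + t • (v - w)‖^2 / s + s) / 2 := by
      have : 0 ≤ (‖ξ + t • (v - w)‖ - s)^2 / s := by positivity
      have e : (‖ξ + t • (v - w)‖ - s)^2 / s =
        ‖ξ + t • (v - w)‖^2 / s - 2 * ‖ξ + t • (v - w)‖ + s := by field_simp; ring
      linarith
    have hq2 := mul_le_mul_of_nonneg_left hq hapos.le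
    rw [nsq x v, nsq y w] at ht
    rw [nsq] at hq2 ht
    rw [← hs] at hq2 ht
    have e3 : a * (((s ^ 2 + 2 * t * inner ℝ ξ (v - w) + t ^ 2 * ‖v - w‖ ^ 2) / s + s) / 2)
      = a * s + (a / s) * t * inner ℝ ξ (v - w) + a / (2 * s) * t^2 * ‖v - w‖^2 := by
      field_simp; ring
    rw [e3] at hq2
    simp only [zero_smul, add_zero]
    linarith
  -- second order
  set e : E := s⁻¹ • ξ with he
  have hen : ‖e‖ = 1 := by
    rw [he, norm_smul, ← hs, norm_inv, Real.norm_eq_abs, abs_of_pos hspos, inv_mul_cancel₀ hsne]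
  set S := (ℝ ∙ e)ᗮ.reflection with hS
  have hSv : ∀ v, v - S v = (2 * inner ℝ e v) • e := by
    intro v
    rw [hS, Submodule.reflection_orthogonal_apply, Submodule.reflection_singleton_apply, hen]
    simp
    module
  have second : ∀ v : E, ‖v‖ = 1 → fderiv ℝ (fderiv ℝ u) x v v - fderiv ℝ (fderiv ℝ u) y (S v) (S v)
      ≤ 2 * (8 * A - 4 * b * (inner ℝ e v)^2) := by
    intro v hv
    have hSn : ‖S v‖ = 1 := by rw [LinearIsometryEquiv.norm_map, hv]
    refine (line_test u x y v (S v) hcx hcy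
      (2 * a * inner ℝ e v - 4 * b * s * inner ℝ e v + 8 * A * (inner ℝ x v + inner ℝ y (S v)))
      _ ?_).2
    have hp : ∀ᶠ t in 𝓝 (0:ℝ), 0 < s + t * (2 * inner ℝ e v) := 
      (Continuous.tendsto' (by fun_prop) 0 s (by simp) :
        Tendsto (fun t : ℝ => s + t * (2 * inner ℝ e v)) (𝓝 0) (𝓝 s)).eventually_const_lt hspos
    filter_upwards [hloc v (S v), hp] with t ht hp
    simp only [hΦ] at ht
    have e1 : (x + t • v) - (y + t • S v) = (s + t * (2 * inner ℝ e v)) • e := by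
      have h1 : (x + t • v) - (y + t • S v) = ξ + t • (v - S v) := by rw [hξ, smul_sub]; abel
      have h2 : ξ = s • e := by rw [he, smul_smul, mul_inv_cancel₀ hsne, one_smul]
      rw [h1, hSv, add_smul, ← h2, smul_smul]
    rw [e1, norm_smul, hen, Real.norm_eq_abs, abs_of_pos hp, nsq x v, nsq y (S v), hv, hSn,
      ← hs] at ht
    simp only [zero_smul, add_zero]
    linarith
  -- sum
  have hsum : Laplacian.laplacian u x - Laplacian.laplacian u y ≤ 32 * n * A - 8 * b := by
    set B := stdOrthonormalBasis ℝ E with hB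
    have l1 := congrFun (InnerProductSpace.laplacian_eq_iteratedFDeriv_orthonormalBasis u B) x
    have l2 := congrFun (InnerProductSpace.laplacian_eq_iteratedFDeriv_orthonormalBasis u (B.map S)) y
    rw [l1, l2]
    simp only [iteratedFDeriv_two_apply, OrthonormalBasis.map_apply]
    rw [← Finset.sum_sub_distrib]
    calc _ ≤ ∑ i, 2 * (8 * A - 4 * b * (inner ℝ e (B i))^2) :=
          Finset.sum_le_sum fun i _ => by simpa using second (B i) (B.norm_eq_one i)
      _ = _ := by
          have h1 : ∑ i, (inner ℝ e (B i))^2 = 1 := by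
            have := B.sum_sq_norm_inner_left e
            simp only [Real.norm_eq_abs, sq_abs, hen] at this
            simpa using this
          rw [← Finset.mul_sum, Finset.sum_sub_distrib, ← Finset.mul_sum _ _ (4 * b), h1]
          simp [hd]
          ring
  rw [hL x (hin x hx), hL y (hin y hy)] at hsum
  have f1 := first x 0
  have f2 := first 0 y
  simp only [map_zero, sub_zero, inner_zero_right, add_zero, zero_sub, zero_add,
    real_inner_self_eq_norm_sq, inner_neg_right] at f1 f2
  set p := a / s - 2 * b with hp
  set X := ‖x‖^2 with hX
  set Y := ‖y‖^2 with hY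
  set Q := inner ℝ x y with hQ
  have i1 : inner ℝ ξ x = X - Q := by
    rw [hξ, inner_sub_left, real_inner_self_eq_norm_sq, real_inner_comm]
  have i2 : inner ℝ ξ y = Q - Y := by
    rw [hξ, inner_sub_left, real_inner_self_eq_norm_sq]
  have i3 : s^2 = X - 2 * Q + Y := by
    rw [hs, hξ, norm_sub_sq_real]
  have f2' : fderiv ℝ u y y = p * (Q - Y) - 8 * A * Y := by
    rw [← i2]; linarith
  rw [f1, f2', i1] at hsum
  have hX4 : X ≤ 1/4 := by rw [hX]; nlinarith [norm_nonneg x]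
  have hY4 : Y ≤ 1/4 := by rw [hY]; nlinarith [norm_nonneg y]
  have hX0 : 0 ≤ X := by positivity
  have hY0 : 0 ≤ Y := by positivity
  have hXY : (X - Y)^2 ≤ s^2 := by
    have h1 : X - Y = (‖x‖ - ‖y‖) * (‖x‖ + ‖y‖) := by rw [hX, hY]; ring
    rw [h1, mul_pow]
    have h2 : (‖x‖ - ‖y‖)^2 ≤ s^2 := sq_le_sq' (abs_le.1 habs).1 (abs_le.1 habs).2
    have h3 : (‖x‖ + ‖y‖)^2 ≤ 1 := pow_le_one₀ (by positivity) (by linarith)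
    exact (mul_le_of_le_one_right (sq_nonneg _) h3).trans h2
  exact final_arith n hn A P a b s p X Y Q hA hspos hPP hP2 ha hbdef hsP' hp i3 hX4 hY4 hX0 hY0 hXY hsum

end Helpers

lemma det_bound {E : Type*} [NormedAddCommGroup E] [InnerProductSpace ℝ E]
    [FiniteDimensional ℝ E] (d : ℕ) (hd : Module.finrank ℝ E = d + 1) (T : E →L[ℝ] E) (M : ℝ)
    (hT : ‖T‖ ≤ M) (hdet : LinearMap.det (T : E →ₗ[ℝ] E) = 1) (v : E) :
    ‖v‖ ≤ M^d * ‖T v‖ := by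
  rcases eq_or_ne v 0 with rfl | hv
  · simp
  have hvn : 0 < ‖v‖ := norm_pos_iff.2 hv
  set e : E := ‖v‖⁻¹ • v with he
  have hen : ‖e‖ = 1 := by rw [he, norm_smul, norm_inv, norm_norm, inv_mul_cancel₀ hvn.ne']
  obtain ⟨B, hB⟩ := Orthonormal.exists_orthonormalBasis_extension_of_card_eq (𝕜 := ℝ) (E := E)
    (ι := Fin (d+1)) (by simpa using hd) (v := fun _ => e) (s := {0}) (by
      constructor
      · intro i; simpa using hen
      · intro i j hij
        exact absurd (Subsingleton.elim i j) hij)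
  have hB0 : B 0 = e := hB 0 (by simp)
  have : Fact (Module.finrank ℝ E = d + 1) := ⟨hd⟩
  have h1 := (B.toBasis.orientation).abs_volumeForm_apply_le (n := d+1) (fun i => T (B i))
  rw [(B.toBasis.orientation).volumeForm_robust' B] at h1
  have h2 : B.toBasis.det (fun i => T (B i)) = 1 := by
    have := B.toBasis.det_comp (T : E →ₗ[ℝ] E) B.toBasis
    rw [hdet, Module.Basis.det_self, mul_one] at this
    rw [← this]
    congr 1
  rw [h2, abs_one, Fin.prod_univ_succ, hB0] at h1
  have h3 : ∏ i : Fin d, ‖T (B i.succ)‖ ≤ M^d := by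
    calc _ ≤ ∏ i : Fin d, M := Finset.prod_le_prod (fun _ _ => norm_nonneg _) fun i _ => by
            have := T.le_of_opNorm_le hT (B i.succ)
            simpa using this
      _ = _ := by simp
  have h4 : ‖T e‖ = ‖v‖⁻¹ * ‖T v‖ := by rw [he, map_smul, norm_smul, norm_inv, norm_norm]
  rw [h4] at h1
  have h5 : 1 ≤ ‖v‖⁻¹ * ‖T v‖ * M^d :=
    h1.trans (mul_le_mul_of_nonneg_left h3 (by positivity))
  have h6 : ‖v‖ * 1 ≤ ‖v‖ * (‖v‖⁻¹ * ‖T v‖ * M^d) := mul_le_mul_of_nonneg_left h5 hvn.le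
  have h7 : ‖v‖ * (‖v‖⁻¹ * ‖T v‖ * M^d) = M^d * ‖T v‖ := by field_simp
  linarith

def stdB (n : ℕ) : OrthonormalBasis (Fin n × Fin 2) ℝ (Cn n) :=
  (Pi.orthonormalBasis (fun _ : Fin n => Complex.orthonormalBasisOneI)).reindex
    (Equiv.sigmaEquivProd _ _)

lemma stdB_zero (n : ℕ) (k : Fin n) : stdB n (k, 0) = EuclideanSpace.single k 1 := by
  simp [stdB]
lemma stdB_one (n : ℕ) (k : Fin n) : stdB n (k, 1) = EuclideanSpace.single k Complex.I := by
  simp [stdB]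

lemma finrank_Cn (n : ℕ) : Module.finrank ℝ (Cn n) = 2 * n := by
  rw [Module.finrank_eq_card_basis (stdB n).toBasis]; simp [mul_comm]

lemma Cn_expand (n : ℕ) (v : Cn n) : v = ∑ k, ((v k).re • EuclideanSpace.single k (1:ℂ) +
    (v k).im • EuclideanSpace.single k Complex.I) := by
  ext j
  simp [Finset.sum_add_distrib, Finset.sum_apply, Pi.single_apply]

def HH (n : ℕ) (u : Cn n → ℝ) : Prop := ContDiffOn ℝ 2 u (ball 0 1) ∧
  ∀ z ∈ ball (0 : Cn n) 1, Laplacian.laplacian u z =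
    - (4 * ((n:ℝ) - 1) / (1 - ‖z‖^2)) * fderiv ℝ u z z

lemma HH_of (n : ℕ) (u : Cn n → ℝ) (hu : ContDiffOn ℝ 2 u (ball 0 1))
    (h : ∀ z ∈ ball (0 : Cn n) 1, laplaceH n u z = 0) : HH n u := by
  refine ⟨hu, fun z hz => ?_⟩
  have hz1 : 0 < 1 - ‖z‖^2 := by
    have : ‖z‖ < 1 := by simpa using hz
    nlinarith [norm_nonneg z]
  have hc : ContDiffAt ℝ 2 u z := hu.contDiffAt (isOpen_ball.mem_nhds hz)
  have hd : DifferentiableAt ℝ (fderiv ℝ u) z :=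
    (hc.fderiv_right (m := 1) (by norm_num)).differentiableAt (by norm_num)
  have e1 : ∀ v : Cn n, fderiv ℝ (fun w => fderiv ℝ u w v) z v = fderiv ℝ (fderiv ℝ u) z v v := by
    intro v
    rw [fderiv_clm_apply hd (differentiableAt_const _)]
    simp
  have l1 := congrFun (InnerProductSpace.laplacian_eq_iteratedFDeriv_orthonormalBasis u (stdB n)) z
  have e2 : Laplacian.laplacian u z = ∑ k, (fderiv ℝ (fderiv ℝ u) z (EuclideanSpace.single k 1)
      (EuclideanSpace.single k 1) + fderiv ℝ (fderiv ℝ u) z (EuclideanSpace.single k Complex.I)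
      (EuclideanSpace.single k Complex.I)) := by
    rw [l1, Fintype.sum_prod_type]
    simp [iteratedFDeriv_two_apply, stdB_zero, stdB_one]
  have e3 : fderiv ℝ u z z = ∑ k, ((z k).re * fderiv ℝ u z (EuclideanSpace.single k 1) +
            (z k).im * fderiv ℝ u z (EuclideanSpace.single k Complex.I)) := by
    have := congrArg (fderiv ℝ u z) (Cn_expand n z)
    rw [map_sum] at this
    rw [this]
    simp
  have h0 := h z hz
  unfold laplaceH at h0
  simp only [e1] at h0
  rw [← e2, ← e3] at h0
  have : (1 - ‖z‖^2) * ((1 - ‖z‖^2) * Laplacian.laplacian u z + 4 * ((n:ℝ) - 1) * fderiv ℝ u z z) = 0 := by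
    linarith
  have := (mul_eq_zero.1 this).resolve_left hz1.ne'
  field_simp
  linarith

lemma HH.add {n : ℕ} {u v : Cn n → ℝ} (hu : HH n u) (hv : HH n v) :
    HH n (fun x => u x + v x) := by
  refine ⟨hu.1.add hv.1, fun z hz => ?_⟩
  have hc : ContDiffAt ℝ 2 u z := hu.1.contDiffAt (isOpen_ball.mem_nhds hz)
  have hc' : ContDiffAt ℝ 2 v z := hv.1.contDiffAt (isOpen_ball.mem_nhds hz)
  have e1 := hc.laplacian_add hc'
  have e2 : fderiv ℝ (fun x => u x + v x) z = fderiv ℝ u z + fderiv ℝ v z :=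
    fderiv_add (hc.differentiableAt (by norm_num)) (hc'.differentiableAt (by norm_num))
  change Laplacian.laplacian (u + v) z = _
  rw [e1, e2, hu.2 z hz, hv.2 z hz, _root_.add_apply]
  ring

lemma HH.smul {n : ℕ} {u : Cn n → ℝ} (hu : HH n u) (c : ℝ) :
    HH n (fun x => c * u x) := by
  refine ⟨contDiffOn_const.mul hu.1, fun z hz => ?_⟩
  have hc : ContDiffAt ℝ 2 u z := hu.1.contDiffAt (isOpen_ball.mem_nhds hz)
  have e1 := InnerProductSpace.laplacian_smul c hc
  have e2 : fderiv ℝ (fun x => c * u x) z = c • fderiv ℝ u z :=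
    fderiv_const_mul (hc.differentiableAt (by norm_num)) c
  change Laplacian.laplacian (c • u) z = _
  rw [e1, e2, hu.2 z hz]
  simp
  ring

lemma HH.sum {n : ℕ} {ι : Type*} (s : Finset ι) (u : ι → Cn n → ℝ) (hu : ∀ i, HH n (u i)) :
    HH n (fun x => ∑ i ∈ s, u i x) := by
  classical
  induction s using Finset.induction_on with
  | empty =>
    refine ⟨by simpa using contDiffOn_const, fun z hz => ?_⟩
    simp
  | insert a s ha ih =>
    simp only [Finset.sum_insert ha]
    exact (hu a).add ih

lemma HH_re_mul {n : ℕ} {F : Cn n → ℂ} (hF : IsHHarmonic n F) (c : ℂ) :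
    HH n (fun x => (c * F x).re) := by
  have h1 : HH n (fun x => (F x).re) :=
    HH_of n _ (Complex.reCLM.contDiff.comp_contDiffOn hF.1) fun z hz => (hF.2 z hz).1
  have h2 : HH n (fun x => (F x).im) :=
    HH_of n _ (Complex.imCLM.contDiff.comp_contDiffOn hF.1) fun z hz => (hF.2 z hz).2
  have := (h1.smul c.re).add (h2.smul (-c.im))
  convert this using 2 with x
  simp [Complex.mul_re]; ring

lemma euclNorm_eq (n : ℕ) (v : Fin n → ℂ) : euclNorm n v = ‖(WithLp.toLp 2 v : Cn n)‖ := by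
  rw [EuclideanSpace.norm_eq]
  simp [euclNorm, Complex.normSq_eq_norm_sq]

lemma matOpNorm_le (n : ℕ) (A : Matrix (Fin n) (Fin n) ℂ) (v : Cn n) :
    ‖(WithLp.toLp 2 (A.mulVec fun k => v k) : Cn n)‖ ≤ matOpNorm n A * ‖v‖ := by
  rcases eq_or_ne v 0 with rfl | hv
  · have : (A.mulVec fun k => (0 : Cn n) k) = 0 := by
      ext i; simp [Matrix.mulVec, dotProduct]
    rw [this]; simp
  have hvn : 0 < ‖v‖ := norm_pos_iff.2 hv
  set e : Cn n := ‖v‖⁻¹ • v with he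
  have hen : ‖e‖ = 1 := by rw [he, norm_smul, norm_inv, norm_norm, inv_mul_cancel₀ hvn.ne']
  have hb : BddAbove ((fun θ : Cn n => euclNorm n (A.mulVec fun k => θ k)) '' sphere (0 : Cn n) 1) := by
    refine ((isCompact_sphere (0 : Cn n) 1).image ?_).bddAbove
    unfold euclNorm Matrix.mulVec dotProduct
    refine Real.continuous_sqrt.comp (continuous_finsetSum _ fun i _ =>
      Complex.continuous_normSq.comp (continuous_finsetSum _ fun j _ => ?_))
    fun_prop
  have h1 : euclNorm n (A.mulVec fun k => e k) ≤ matOpNorm n A :=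
    le_csSup hb ⟨e, by simpa using hen, rfl⟩
  rw [euclNorm_eq] at h1
  have h2 : (WithLp.toLp 2 (A.mulVec fun k => v k) : Cn n) =
      ‖v‖ • (WithLp.toLp 2 (A.mulVec fun k => e k) : Cn n) := by
    ext i
    have : ∀ k, v k = (‖v‖ : ℂ) * e k := by
      intro k
      have h := congrArg (fun w : Cn n => w k) he
      simp only [PiLp.smul_apply, Complex.real_smul] at h
      rw [h]
      have : (‖v‖ : ℂ) ≠ 0 := by exact_mod_cast hvn.ne'
      push_cast
      field_simp
    simp only [PiLp.smul_apply, Complex.real_smul, Matrix.mulVec, dotProduct, Finset.mul_sum]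
    refine Finset.sum_congr rfl fun k _ => ?_
    rw [this k]; ring
  rw [h2, norm_smul, norm_norm, mul_comm]
  exact mul_le_mul_of_nonneg_right h1 hvn.le

lemma fderiv_coord (n : ℕ) (f : Cn n → Cn n) (x : Cn n) (hf : DifferentiableAt ℝ f x) (j : Fin n) (v : Cn n) :
    fderiv ℝ (fun w => f w j) x v = (fderiv ℝ f x v) j := by
  have := ((PiLp.proj (𝕜 := ℝ) 2 (fun _ : Fin n => ℂ) j).hasFDerivAt.comp x hf.hasFDerivAt).fderiv
  have h2 := congrArg (fun L => L v) this
  exact h2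

lemma fderiv_expand (n : ℕ) (f : Cn n → Cn n) (x : Cn n) (hf : DifferentiableAt ℝ f x) (j : Fin n) (v : Cn n) :
    (fderiv ℝ f x v) j = ∑ k, (fzMat n f x j k * v k + fzbarMat n f x j k * (starRingEnd ℂ) (v k)) := by
  rw [← fderiv_coord n f x hf]
  conv_lhs => rw [Cn_expand n v]
  rw [map_sum]
  refine Finset.sum_congr rfl fun k _ => ?_
  rw [map_add, map_smul, map_smul]
  unfold fzMat fzbarMat wdz wdzbar
  simp only [Complex.real_smul]
  set p := fderiv ℝ (fun w => f w j) x (EuclideanSpace.single k 1)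
  set q := fderiv ℝ (fun w => f w j) x (EuclideanSpace.single k Complex.I)
  have h1 : v k = (v k).re + (v k).im * Complex.I := (Complex.re_add_im _).symm
  have h2 : (starRingEnd ℂ) (v k) = (v k).re - (v k).im * Complex.I := by
    apply Complex.ext <;> simp
  rw [h2]
  conv_rhs => rw [h1]
  ring_nf
  simp
  ring

lemma fderiv_norm_le (n : ℕ) (f : Cn n → Cn n) (x : Cn n) (hf : DifferentiableAt ℝ f x) (v : Cn n) :
    ‖fderiv ℝ f x v‖ ≤ (matOpNorm n (fzMat n f x) + matOpNorm n (fzbarMat n f x)) * ‖v‖ := by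
  set v' : Cn n := WithLp.toLp 2 fun k => (starRingEnd ℂ) (v k) with hv'
  have hn : ‖v'‖ = ‖v‖ := by
    rw [EuclideanSpace.norm_eq, EuclideanSpace.norm_eq]; simp [hv']
  have h1 : fderiv ℝ f x v = (WithLp.toLp 2 ((fzMat n f x).mulVec fun k => v k) : Cn n) +
      (WithLp.toLp 2 ((fzbarMat n f x).mulVec fun k => v' k) : Cn n) := by
    ext j
    rw [fderiv_expand n f x hf]
    simp [Matrix.mulVec, dotProduct, hv', Finset.sum_add_distrib]
  rw [h1, add_mul]
  refine (norm_add_le _ _).trans (add_le_add (matOpNorm_le n _ v) ?_)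
  rw [← hn]
  exact matOpNorm_le n _ v'

lemma realJac_det (n : ℕ) (f : Cn n → Cn n) (x : Cn n) (hf : DifferentiableAt ℝ f x) :
    (realJac n f x).det = LinearMap.det (fderiv ℝ f x : Cn n →ₗ[ℝ] Cn n) := by
  rw [← LinearMap.det_toMatrix (stdB n).toBasis]
  congr 1
  have hre : ∀ j v, fderiv ℝ (fun w => (f w j).re) x v = ((fderiv ℝ f x v) j).re := by
    intro j v
    have h0 : DifferentiableAt ℝ (fun w => f w j) x :=
      (PiLp.proj (𝕜 := ℝ) 2 (fun _ : Fin n => ℂ) j).differentiableAt.comp x hf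
    have := (Complex.reCLM.hasFDerivAt.comp x h0.hasFDerivAt).fderiv
    have h2 := congrArg (fun L => L v) this
    rw [← fderiv_coord n f x hf]
    exact h2
  have him : ∀ j v, fderiv ℝ (fun w => (f w j).im) x v = ((fderiv ℝ f x v) j).im := by
    intro j v
    have h0 : DifferentiableAt ℝ (fun w => f w j) x :=
      (PiLp.proj (𝕜 := ℝ) 2 (fun _ : Fin n => ℂ) j).differentiableAt.comp x hf
    have := (Complex.imCLM.hasFDerivAt.comp x h0.hasFDerivAt).fderiv
    have h2 := congrArg (fun L => L v) this
    rw [← fderiv_coord n f x hf]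
    exact h2
  have hB : ∀ q : Fin n × Fin 2, stdB n q =
      EuclideanSpace.single q.1 (if q.2 = 0 then 1 else Complex.I) := by
    rintro ⟨k, i⟩
    fin_cases i
    · simpa using stdB_zero n k
    · simpa using stdB_one n k
  ext p q
  rw [LinearMap.toMatrix_apply]
  unfold realJac
  rw [hre, him, ← hB q]
  obtain ⟨j, i⟩ := p
  have hr : ∀ y : Cn n, (stdB n).repr y (j, i) = if i = 0 then (y j).re else (y j).im := by
    intro y
    rw [OrthonormalBasis.repr_apply_apply, hB]
    fin_cases i <;> simp [PiLp.inner_apply, apply_ite, Complex.inner]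
  simp [hr]

lemma inner_HH (n : ℕ) (f : Cn n → Cn n) (hf : IsPHH n f) (v w : Cn n) :
    ∃ U : Cn n → ℝ, HH n U ∧ ∀ x ∈ ball (0 : Cn n) 1, U x = inner ℝ w (fderiv ℝ f x v) := by
  refine ⟨fun x => ∑ j, ∑ k, (((starRingEnd ℂ) (w j) * v k * fzMat n f x j k).re +
    ((starRingEnd ℂ) (w j) * (starRingEnd ℂ) (v k) * fzbarMat n f x j k).re), ?_, ?_⟩
  · exact HH.sum _ _ fun j => HH.sum _ _ fun k =>
      (HH_re_mul (hf.2 j k).1 _).add (HH_re_mul (hf.2 j k).2 _)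
  · intro x hx
    have hd : DifferentiableAt ℝ f x :=
      (hf.1.contDiffAt (isOpen_ball.mem_nhds hx)).differentiableAt (by norm_num)
    rw [PiLp.inner_apply]
    refine Finset.sum_congr rfl fun j _ => ?_
    rw [fderiv_expand n f x hd, Complex.inner, Finset.sum_mul, Complex.re_sum]
    refine Finset.sum_congr rfl fun k _ => ?_
    rw [← Complex.add_re]
    congr 1
    ring

lemma fderiv_diff (n : ℕ) (hn : 1 ≤ n) (f : Cn n → Cn n) (hf : IsPHH n f) (A : ℝ) (hA : 0 < A)
    (hb : ∀ x : Cn n, ‖x‖ ≤ 1/2 → ‖fderiv ℝ f x‖ ≤ A) (x : Cn n) (hx : ‖x‖ ≤ 1 / 2^n) :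
    ‖fderiv ℝ f x - fderiv ℝ f 0‖ ≤ (4 * 2^n * A + 4 * A * ‖x‖) * ‖x‖ := by
  have hx2 : ‖x‖ ≤ 1/2 := hx.trans (by
    apply one_div_le_one_div_of_le (by norm_num)
    calc (2:ℝ) = 2^1 := by norm_num
      _ ≤ 2^n := pow_le_pow_right₀ (by norm_num) hn)
  have hin : ∀ z : Cn n, ‖z‖ ≤ 1/2 → z ∈ ball (0:Cn n) 1 := fun z hz => by
    simp; linarith
  have key : ∀ v w : Cn n, ‖v‖ = 1 → ‖w‖ = 1 →
      inner ℝ w ((fderiv ℝ f x - fderiv ℝ f 0) v) ≤ (4 * 2^n * A + 4 * A * ‖x‖) * ‖x‖ := by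
    intro v w hv hw
    obtain ⟨U, hU, hUe⟩ := inner_HH n f hf v w
    have h := max_principle n hn (finrank_Cn n) U hU.1 hU.2 A hA (fun y hy => by
      rw [hUe y (hin y hy)]
      refine (abs_real_inner_le_norm _ _).trans ?_
      rw [hw, one_mul]
      simpa [hv] using (fderiv ℝ f y).le_of_opNorm_le (hb y hy) v) x 0 hx2 (by simp) (by simpa using hx)
    rw [hUe x (hin x hx2), hUe 0 (hin 0 (by simp))] at h
    rw [_root_.sub_apply, inner_sub_right]
    simp only [sub_zero, norm_zero] at h
    have : 0 ≤ 2 * 4^n * A * ‖x‖^2 := by positivity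
    linarith
  refine ContinuousLinearMap.opNorm_le_bound _ (by positivity) fun v => ?_
  set D := fderiv ℝ f x - fderiv ℝ f 0 with hD
  rcases eq_or_ne v 0 with rfl | hv
  · simp
  rcases eq_or_ne (D v) 0 with h0 | h0
  · rw [h0, norm_zero]; positivity
  have h1 : 0 < ‖v‖ := norm_pos_iff.2 hv
  have h2 : 0 < ‖D v‖ := norm_pos_iff.2 h0
  have := key (‖v‖⁻¹ • v) (‖D v‖⁻¹ • D v)
    (by rw [norm_smul, norm_inv, norm_norm, inv_mul_cancel₀ h1.ne'])
    (by rw [norm_smul, norm_inv, norm_norm, inv_mul_cancel₀ h2.ne'])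
  rw [map_smul, inner_smul_left, inner_smul_right, real_inner_self_eq_norm_sq] at this
  simp only [conj_trivial] at this
  have e : ‖D v‖⁻¹ * (‖v‖⁻¹ * ‖D v‖^2) = ‖D v‖ / ‖v‖ := by field_simp
  rw [e, div_le_iff₀ h1] at this
  exact this
/-- Let `α, M > 0` and let `f : Bⁿ → ℂⁿ` be continuously differentiable with
all Wirtinger partial derivatives `h`-harmonic, `f(0) = 0`, `det J_f(0) = 1`, and
`sup_{z∈Bⁿ} (1−|z|²)^α (|f_z(z)| + |f_{z̄}(z)|) ≤ M`. Then `f` is univalent on `Bⁿ(ρ/2)`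
where `ρ = 3^α/((2M)^{2n}(3^α + 4^α))`. -/
theorem landau_bloch_univalent (n : ℕ) (hn : 1 ≤ n) (α M : ℝ) (hα : 0 < α) (hM : 0 < M)
    (f : Cn n → Cn n) (hf : IsPHH n f) (hf0 : f 0 = 0)
    (hjac : (realJac n f 0).det = 1)
    (hbd : ∀ z ∈ ball (0 : Cn n) 1,
      (1 - ‖z‖ ^ 2) ^ α * (matOpNorm n (fzMat n f z) + matOpNorm n (fzbarMat n f z)) ≤ M) :
    Set.InjOn f
      (ball 0 ((3 : ℝ) ^ α / ((2 * M) ^ (2 * n) * ((3 : ℝ) ^ α + (4 : ℝ) ^ α)) / 2)) := by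
  have hdiff : ∀ x ∈ ball (0 : Cn n) 1, DifferentiableAt ℝ f x := fun x hx =>
    (hf.1.contDiffAt (isOpen_ball.mem_nhds hx)).differentiableAt (by norm_num)
  have h00 : (0 : Cn n) ∈ ball (0 : Cn n) 1 := by simp
  have hnn : ∀ A, 0 ≤ matOpNorm n A := fun A => by
    unfold matOpNorm
    apply Real.sSup_nonneg
    rintro _ ⟨θ, -, rfl⟩
    exact Real.sqrt_nonneg _
  set q : ℝ := (4/3 : ℝ)^α with hq
  have hq1 : 1 ≤ q := Real.one_le_rpow (by norm_num) hα.le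
  have hT : ‖fderiv ℝ f 0‖ ≤ M := by
    refine ContinuousLinearMap.opNorm_le_bound _ hM.le fun v => ?_
    refine (fderiv_norm_le n f 0 (hdiff 0 h00) v).trans ?_
    have := hbd 0 h00
    simp at this
    exact mul_le_mul_of_nonneg_right this (norm_nonneg _)
  have hbA : ∀ x : Cn n, ‖x‖ ≤ 1/2 → ‖fderiv ℝ f x‖ ≤ M * q := by
    intro x hx
    have hxb : x ∈ ball (0 : Cn n) 1 := by simp; linarith
    refine ContinuousLinearMap.opNorm_le_bound _ (by positivity) fun v => ?_
    refine (fderiv_norm_le n f x (hdiff x hxb) v).trans ?_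
    refine mul_le_mul_of_nonneg_right ?_ (norm_nonneg _)
    have h1 := hbd x hxb
    set S := matOpNorm n (fzMat n f x) + matOpNorm n (fzbarMat n f x) with hS
    have hS0 : 0 ≤ S := add_nonneg (hnn _) (hnn _)
    have h2 : (3/4 : ℝ)^α ≤ (1 - ‖x‖^2)^α :=
      Real.rpow_le_rpow (by norm_num) (by nlinarith [norm_nonneg x]) hα.le
    have h3 : (3/4 : ℝ)^α * S ≤ M := (mul_le_mul_of_nonneg_right h2 hS0).trans h1
    have h4 : q * (3/4 : ℝ)^α = 1 := by
      rw [hq, ← Real.mul_rpow (by norm_num) (by norm_num)]; norm_num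
    calc S = q * ((3/4 : ℝ)^α * S) := by rw [← mul_assoc, h4, one_mul]
      _ ≤ q * M := mul_le_mul_of_nonneg_left h3 (by positivity)
      _ = M * q := mul_comm _ _
  have hdet : LinearMap.det (fderiv ℝ f 0 : Cn n →ₗ[ℝ] Cn n) = 1 := by
    rw [← realJac_det n f 0 (hdiff 0 h00)]; exact hjac
  have hlow : ∀ v, ‖v‖ ≤ M^(2*n-1) * ‖fderiv ℝ f 0 v‖ := fun v =>
    det_bound (2*n-1) (by rw [finrank_Cn]; omega) _ M hT hdet v
  have hMM : M^(2*n) = M^(2*n-1) * M := by rw [← pow_succ]; congr 1; omega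
  have hM1 : 1 ≤ M := by
    have k := hlow (EuclideanSpace.single ⟨0, hn⟩ 1)
    have k2 := (fderiv ℝ f 0).le_of_opNorm_le hT (EuclideanSpace.single ⟨0, hn⟩ 1)
    have k3 := mul_le_mul_of_nonneg_left k2 (by positivity : 0 ≤ M^(2*n-1))
    rw [← mul_assoc, ← hMM] at k3
    have k4 : (1:ℝ) ≤ M^(2*n) := by
      have := k.trans k3
      simpa using this
    by_contra hc
    push Not at hc
    exact absurd k4 (not_le.2 (pow_lt_one₀ hM.le hc (by omega)))
  set m := M^(2*n-1) with hm
  have hm1 : 1 ≤ m := one_le_pow₀ hM1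
  have hρ : (3 : ℝ) ^ α / ((2 * M) ^ (2 * n) * ((3 : ℝ) ^ α + (4 : ℝ) ^ α)) / 2 =
      1 / (2 * 4^n * (m * M) * (1 + q)) := by
    have h3 : (0:ℝ) < 3^α := by positivity
    have : (4:ℝ)^α = 3^α * q := by
      rw [hq, ← Real.mul_rpow (by norm_num) (by norm_num)]; norm_num
    rw [this, mul_pow, hMM, pow_mul]
    norm_num
    field_simp
  rw [hρ]
  set R := 1 / (2 * 4^n * (m * M) * (1 + q)) with hR
  have hRpos : 0 < R := by positivity
  have hRe : R * (2 * 4^n * (m * M) * (1 + q)) = 1 := by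
    rw [hR]; field_simp
  have h42 : (2:ℝ)^n ≤ 4^n := pow_le_pow_left₀ (by norm_num) (by norm_num) n
  have h2n : (2:ℝ) ≤ 2^n := by
    calc (2:ℝ) = 2^1 := by norm_num
      _ ≤ 2^n := pow_le_pow_right₀ (by norm_num) hn
  have h4n : (4:ℝ)^n = 2^n * 2^n := by rw [← mul_pow]; norm_num
  have hmM : 1 ≤ m * M := one_le_mul_of_one_le_of_one_le hm1 hM1
  have hR2 : R ≤ 1 / 2^n := by
    rw [hR]
    apply one_div_le_one_div_of_le (by positivity)
    calc (2:ℝ)^n ≤ 4^n := h42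
      _ = 4^n * 1 * 1 := by ring
      _ ≤ (2 * 4^n) * (m * M) * (1 + q) := by gcongr <;> linarith
  have hqR : q * R ≤ 1 := by
    rw [← hRe, mul_comm]
    refine mul_le_mul_of_nonneg_left ?_ hRpos.le
    calc q = 1 * 1 * q := by ring
      _ ≤ (2 * 4^n) * (m * M) * (1 + q) := by gcongr <;> linarith
  intro x hx y hy hxy
  have hx' : ‖x‖ < R := by simpa using hx
  have hy' : ‖y‖ < R := by simpa using hy
  set r := max ‖x‖ ‖y‖ with hr
  have hrR : r < R := max_lt hx' hy'
  have hr0 : 0 ≤ r := (norm_nonneg x).trans (le_max_left _ _)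
  set C := 2 * 4^n * M * (1 + q) * r with hC
  have hR12 : R ≤ 1/2 := hR2.trans (one_div_le_one_div_of_le (by norm_num) h2n)
  have hcoef : 4 * 2^n * (M * q) + 4 * (M * q) * R ≤ 2 * 4^n * M * (1 + q) := by
    have e1 : 4 * 2^n * (M * q) ≤ 2 * 4^n * (M * q) := by
      refine mul_le_mul_of_nonneg_right ?_ (by positivity)
      rw [h4n]; nlinarith
    have e2 : 4 * (M * q) * R ≤ 4 * M := by
      have := mul_le_mul_of_nonneg_left hqR hM.le
      linarith
    have e3 : 4 * M ≤ 2 * 4^n * M := mul_le_mul_of_nonneg_right (by linarith) hM.le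
    linarith
  have hbound : ∀ z ∈ closedBall (0 : Cn n) r, ‖fderiv ℝ f z - fderiv ℝ f 0‖ ≤ C := by
    intro z hz
    have hz' : ‖z‖ ≤ r := by simpa using hz
    refine (fderiv_diff n hn f hf (M * q) (by positivity) hbA z (by linarith)).trans ?_
    rw [hC]
    refine mul_le_mul (le_trans ?_ hcoef) hz' (norm_nonneg _) (by positivity)
    have : 4 * (M * q) * ‖z‖ ≤ 4 * (M * q) * R :=
      mul_le_mul_of_nonneg_left (by linarith) (by positivity)
    linarith
  have hmv := (convex_closedBall (0 : Cn n) r).norm_image_sub_le_of_norm_hasFDerivWithin_le'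
    (f := f) (f' := fun z => fderiv ℝ f z) (φ := fderiv ℝ f 0) (C := C)
    (x := x) (y := y) (fun z hz => (hdiff z (by
      have hz' : ‖z‖ ≤ r := by simpa using hz
      simp; linarith)).hasFDerivAt.hasFDerivWithinAt) hbound
    (by simp [hr]) (by simp [hr])
  rw [hxy, sub_self, zero_sub, norm_neg] at hmv
  by_contra hne
  have hpos : 0 < ‖y - x‖ := norm_pos_iff.2 (sub_ne_zero.2 (Ne.symm hne))
  have h1 := (hlow (y - x)).trans (mul_le_mul_of_nonneg_left hmv (by positivity))
  have h2 : m * C < 1 := by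
    rw [← hRe, hC]
    have : m * (2 * 4^n * M * (1 + q) * r) = r * (2 * 4^n * (m * M) * (1 + q)) := by ring
    rw [this]
    exact mul_lt_mul_of_pos_right hrR (by positivity)
  nlinarith
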